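/- For a core Δ-structure G the following conditions are equivalent: (1) whenever G → A + B for Δ-structures A, B, then G → A or G → B; (2) whenever G ≈ A + B, then A → B or B → A; (3) whenever G ≈ A + B, then G ≈ A or G ≈ B; (4) the shadow Sh(G) is connected. -/

import Mathlib

/-! Framework: finite relational structures of a fixed type Δ = (δ i : i ∈ I),
homomorphisms, cores, sums, products, exponentials, shadows, trees, forests,
duality pairs, finite dualities, transversals, antichains. -/

namespace ThesisFormal

/-- A finite relational structure of type `Δ = (δ i : i ∈ I)`:
a finite nonempty base set together with a `δ i`-ary relation for each `i ∈ I`. -/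
structure RelStruct (I : Type) (δ : I → ℕ) : Type 1 where
  carrier : Type
  finite : Finite carrier
  nonempty : Nonempty carrier
  rel : ∀ i : I, Set ((Fin (δ i)) → carrier)

namespace RelStruct

variable {I : Type} {δ : I → ℕ}

/-- `f` is a homomorphism from `A` to `B`. -/
def IsHom (A B : RelStruct I δ) (f : A.carrier → B.carrier) : Prop :=
  ∀ i : I, ∀ e ∈ A.rel i, (f ∘ e) ∈ B.rel i

/-- `A → B`: some homomorphism from `A` to `B` exists. -/
def HomTo (A B : RelStruct I δ) : Prop := ∃ f, IsHom A B f

/-- `A ≈ B`: homomorphic equivalence. -/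
def HomEquiv (A B : RelStruct I δ) : Prop := HomTo A B ∧ HomTo B A

/-- `A` and `B` are incomparable: no homomorphism either way. -/
def Incomparable (A B : RelStruct I δ) : Prop := ¬ HomTo A B ∧ ¬ HomTo B A

/-- `A ≅ B`: a bijective homomorphism whose inverse is also a homomorphism. -/
def Isomorphic (A B : RelStruct I δ) : Prop :=
  ∃ f : A.carrier ≃ B.carrier, IsHom A B f ∧ IsHom B A f.symm

/-- A retraction of `A`: an endomorphism fixing its image pointwise. -/
def IsRetraction (A : RelStruct I δ) (f : A.carrier → A.carrier) : Prop :=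
  IsHom A A f ∧ ∀ x ∈ Set.range f, f x = x

/-- A core: a structure with no proper retracts (every retraction is surjective). -/
def IsCore (A : RelStruct I δ) : Prop :=
  ∀ f, IsRetraction A f → Function.Surjective f

/-- The substructure of `A` induced by a nonempty `S ⊆ |A|`. -/
noncomputable def Substruct (A : RelStruct I δ) (S : Set A.carrier) (hS : S.Nonempty) :
    RelStruct I δ where
  carrier := S
  finite := by haveI := A.finite; exact Subtype.finite
  nonempty := hS.to_subtype
  rel i := {e | (fun j => (e j : A.carrier)) ∈ A.rel i}

/-- `C` is a retract of `A`: the substructure induced by the image of a retraction. -/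
def IsRetractOf (C A : RelStruct I δ) : Prop :=
  ∃ f, IsRetraction A f ∧
    C = A.Substruct (Set.range f) ⟨f A.nonempty.some, Set.mem_range_self _⟩

/-- The sum (disjoint union) `A + B`. -/
noncomputable def sum (A B : RelStruct I δ) : RelStruct I δ where
  carrier := A.carrier ⊕ B.carrier
  finite := by haveI := A.finite; haveI := B.finite; infer_instance
  nonempty := ⟨Sum.inl A.nonempty.some⟩
  rel i := {e | (∃ ea ∈ A.rel i, e = Sum.inl ∘ ea) ∨ (∃ eb ∈ B.rel i, e = Sum.inr ∘ eb)}

/-- The product `A × B`. -/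
noncomputable def prod (A B : RelStruct I δ) : RelStruct I δ where
  carrier := A.carrier × B.carrier
  finite := by haveI := A.finite; haveI := B.finite; infer_instance
  nonempty := ⟨(A.nonempty.some, B.nonempty.some)⟩
  rel i := {e | (fun j => (e j).1) ∈ A.rel i ∧ (fun j => (e j).2) ∈ B.rel i}

/-- The exponential structure `C ^ B`. -/
noncomputable def exp (C B : RelStruct I δ) : RelStruct I δ where
  carrier := B.carrier → C.carrier
  finite := by haveI := B.finite; haveI := C.finite; infer_instance
  nonempty := ⟨fun _ => C.nonempty.some⟩
  rel i := {f | ∀ e ∈ B.rel i, (fun j => f j (e j)) ∈ C.rel i}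

/-- The sum of a finite nonempty family of structures. -/
noncomputable def sigmaSum {J : Type} (hJfin : Finite J) (hJne : Nonempty J)
    (A : J → RelStruct I δ) : RelStruct I δ where
  carrier := Σ j, (A j).carrier
  finite := by
    haveI := hJfin
    haveI : ∀ j, Finite ((A j).carrier) := fun j => (A j).finite
    infer_instance
  nonempty := ⟨⟨hJne.some, (A hJne.some).nonempty.some⟩⟩
  rel i := {e | ∃ j, ∃ ea ∈ (A j).rel i, e = fun k => ⟨j, ea k⟩}

/-- The product of a finite family of structures. -/
noncomputable def piProd {J : Type} (hJfin : Finite J)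
    (A : J → RelStruct I δ) : RelStruct I δ where
  carrier := ∀ j, (A j).carrier
  finite := by
    haveI := hJfin
    haveI : ∀ j, Finite ((A j).carrier) := fun j => (A j).finite
    infer_instance
  nonempty := ⟨fun j => (A j).nonempty.some⟩
  rel i := {e | ∀ j, (fun k => e k j) ∈ (A j).rel i}

/-- An edge of the shadow multigraph `Sh(A)`: one edge joining `e j` and `e (j+1)`
for each edge `e ∈ R i (A)` and each `j` with `j + 1 < δ i`. -/
structure ShadowEdge (A : RelStruct I δ) : Type where
  i : I
  e : Fin (δ i) → A.carrier
  mem : e ∈ A.rel i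
  j : ℕ
  hj : j + 1 < δ i

/-- First endpoint of a shadow edge. -/
def ShadowEdge.src {A : RelStruct I δ} (s : ShadowEdge A) : A.carrier :=
  s.e ⟨s.j, Nat.lt_of_succ_lt s.hj⟩

/-- Second endpoint of a shadow edge. -/
def ShadowEdge.tgt {A : RelStruct I δ} (s : ShadowEdge A) : A.carrier :=
  s.e ⟨s.j + 1, s.hj⟩

/-- The adjacency relation of the shadow `Sh(A)`. -/
def shadowAdj (A : RelStruct I δ) (a b : A.carrier) : Prop :=
  ∃ s : ShadowEdge A, (s.src = a ∧ s.tgt = b) ∨ (s.src = b ∧ s.tgt = a)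

/-- The shadow of `A` is connected. -/
def ShadowConnected (A : RelStruct I δ) : Prop :=
  ∀ a b : A.carrier, Relation.ReflTransGen (shadowAdj A) a b

/-- `A` is a Δ-tree: its shadow multigraph is a tree, i.e. it is connected and
the number of edge occurrences is one less than the number of vertices
(this rules out cycles, loops and parallel edges). -/
def IsTreeStruct (A : RelStruct I δ) : Prop :=
  ShadowConnected A ∧ Nat.card (ShadowEdge A) + 1 = Nat.card A.carrier

/-- The number of connected components of the shadow of `A`. -/
noncomputable def numComponents (A : RelStruct I δ) : ℕ :=
  Nat.card (Quot (shadowAdj A))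

/-- `A` is a Δ-forest: every component of its shadow multigraph is a tree. -/
def IsForestStruct (A : RelStruct I δ) : Prop :=
  Nat.card (ShadowEdge A) + numComponents A = Nat.card A.carrier

/-- The component of `A` containing the vertex `a`. -/
noncomputable def componentOf (A : RelStruct I δ) (a : A.carrier) : RelStruct I δ :=
  A.Substruct {b | Relation.ReflTransGen (shadowAdj A) a b}
    ⟨a, Relation.ReflTransGen.refl⟩

/-- `(F, D)` is a duality pair: for every `A`, `F → A` iff `A ↛ D`. -/
def DualityPair (F D : RelStruct I δ) : Prop :=
  ∀ A : RelStruct I δ, HomTo F A ↔ ¬ HomTo A D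

/-- `(F, D)` is a finite homomorphism duality: `F` and `D` are finite sets of
pairwise incomparable cores and for every `X`, some member of `F` maps to `X`
iff `X` maps to no member of `D`. -/
def FiniteDuality (F D : Set (RelStruct I δ)) : Prop :=
  F.Finite ∧ D.Finite ∧
  (∀ A ∈ F, IsCore A) ∧ (∀ A ∈ D, IsCore A) ∧
  F.Pairwise Incomparable ∧ D.Pairwise Incomparable ∧
  ∀ X : RelStruct I δ, (∃ A ∈ F, HomTo A X) ↔ (∀ B ∈ D, ¬ HomTo X B)

/-- The set of connected components of `A`. -/
def componentsSet (A : RelStruct I δ) : Set (RelStruct I δ) :=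
  {C | ∃ a : A.carrier, C = componentOf A a}

/-- The set `ℱ_c` of connected components of the members of `F`. -/
def componentsOfFamily (F : Set (RelStruct I δ)) : Set (RelStruct I δ) :=
  ⋃ A ∈ F, componentsSet A

/-- A quasitransversal over `F`: a set of pairwise incomparable components of
members of `F` supporting `F`. -/
def Quasitransversal (F M : Set (RelStruct I δ)) : Prop :=
  M ⊆ componentsOfFamily F ∧ M.Pairwise Incomparable ∧
  ∀ A ∈ F, ∃ C ∈ M, HomTo C A

/-- The order on quasitransversals: `M ⪯ M'` iff every member of `M'` admits a
homomorphism from some member of `M`. -/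
def QTle (M M' : Set (RelStruct I δ)) : Prop :=
  ∀ C' ∈ M', ∃ C ∈ M, HomTo C C'

/-- A transversal: a `⪯`-maximal quasitransversal. -/
def IsTransversal (F M : Set (RelStruct I δ)) : Prop :=
  Quasitransversal F M ∧ ∀ M', Quasitransversal F M' → QTle M M' → M' = M

/-- The product of a family of structures indexed by `Fin n`. -/
noncomputable def finProd (n : ℕ) (A : Fin n → RelStruct I δ) : RelStruct I δ :=
  piProd (inferInstance : Finite (Fin n)) A

/-- `D` is (isomorphic to) `D(M)`, the core of the product of the duals `D(C)`
of the members `C` of the finite set `M`. -/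
def IsSetDual (M : Set (RelStruct I δ)) (D : RelStruct I δ) : Prop :=
  IsCore D ∧ ∃ (n : ℕ) (C DC : Fin n → RelStruct I δ),
    Function.Injective C ∧ Set.range C = M ∧
    (∀ k, IsCore (DC k) ∧ DualityPair (C k) (DC k)) ∧
    HomEquiv D (finProd n DC)

/-- `D` is the result (up to isomorphism) of the transversal construction on `F`:
its members are exactly the duals of the transversals over `F`, one for each
transversal. -/
def TransversalDualSet (F D : Set (RelStruct I δ)) : Prop :=
  (∀ d ∈ D, ∃ M, IsTransversal F M ∧ IsSetDual M d) ∧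
  (∀ M, IsTransversal F M → ∃ d ∈ D, IsSetDual M d) ∧
  (∀ d ∈ D, ∀ d' ∈ D, ∀ M : Set (RelStruct I δ),
    IsSetDual M d → IsSetDual M d' → d = d')

/-- `Q` is a maximal antichain in the homomorphism order: a set of pairwise
incomparable cores such that every structure is comparable with some member. -/
def IsMaxAntichain (Q : Set (RelStruct I δ)) : Prop :=
  (∀ A ∈ Q, IsCore A) ∧ Q.Pairwise Incomparable ∧
  ∀ X : RelStruct I δ, ∃ A ∈ Q, HomTo X A ∨ HomTo A X

/-- The maximal antichain `Q` splits. -/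
def Splits (Q : Set (RelStruct I δ)) : Prop :=
  ∃ Q₁ Q₂ : Set (RelStruct I δ), Q₁ ∪ Q₂ = Q ∧ Disjoint Q₁ Q₂ ∧
    ∀ X : RelStruct I δ, (∃ A ∈ Q₁, HomTo A X) ∨ (∃ B ∈ Q₂, HomTo X B)

/-- `A < B` in the homomorphism order. -/
def StrictHom (A B : RelStruct I δ) : Prop := HomTo A B ∧ ¬ HomTo B A

/-- (The homomorphic-equivalence class of) `Y` is a cutting point in the
homomorphism order. -/
def CuttingPoint (Y : RelStruct I δ) : Prop :=
  ∃ X Z : RelStruct I δ, StrictHom X Y ∧ StrictHom Y Z ∧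
    ∀ W : RelStruct I δ, HomTo X W → HomTo W Z → (HomTo W Y ∨ HomTo Y W)

/-- `A` has at most one edge of each kind. -/
def AtMostOneEdgePerKind (A : RelStruct I δ) : Prop :=
  ∀ i : I, ∀ e ∈ A.rel i, ∀ e' ∈ A.rel i, e = e'

end RelStruct

end ThesisFormal

namespace ThesisFormal

namespace RelStruct

variable {I : Type} {δ : I → ℕ}

theorem HomTo.trans {A B C : RelStruct I δ} (h : A.HomTo B) (h' : B.HomTo C) : A.HomTo C := by
  obtain ⟨f, hf⟩ := h
  obtain ⟨g, hg⟩ := h'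
  exact ⟨g ∘ f, fun i e he => hg i _ (hf i e he)⟩

theorem HomTo.refl (A : RelStruct I δ) : A.HomTo A := ⟨id, fun _ _ he => he⟩

theorem homTo_sum_left (A B : RelStruct I δ) : A.HomTo (A.sum B) :=
  ⟨Sum.inl, fun _ e he => Or.inl ⟨e, he, rfl⟩⟩

theorem homTo_sum_right (A B : RelStruct I δ) : B.HomTo (A.sum B) :=
  ⟨Sum.inr, fun _ e he => Or.inr ⟨e, he, rfl⟩⟩

theorem sum_homTo {A B C : RelStruct I δ} (hA : A.HomTo C) (hB : B.HomTo C) :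
    (A.sum B).HomTo C := by
  obtain ⟨f, hf⟩ := hA
  obtain ⟨g, hg⟩ := hB
  refine ⟨Sum.elim f g, ?_⟩
  rintro i _ (⟨e, he, rfl⟩ | ⟨e, he, rfl⟩)
  · exact hf i e he
  · exact hg i e he

theorem substruct_homTo (A : RelStruct I δ) (S : Set A.carrier) (hS : S.Nonempty) :
    (A.Substruct S hS).HomTo A :=
  ⟨Subtype.val, fun _ _ he => he⟩

theorem IsHom.iterate {A : RelStruct I δ} {f : A.carrier → A.carrier} (hf : IsHom A A f)
    (n : ℕ) : IsHom A A f^[n] := by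
  induction n with
  | zero => exact fun _ _ he => he
  | succ n ih => exact fun i e he => ih i _ (hf i e he)

theorem exists_iterate_idempotent {α : Type*} [Finite α] (f : α → α) :
    ∃ n, 0 < n ∧ ∀ x, f^[n] (f^[n] x) = f^[n] x := by
  obtain ⟨m, n, hmn, h⟩ : ∃ m n, m < n ∧ f^[m + 1] = f^[n + 1] := by
    obtain ⟨m, n, hne, h⟩ := Finite.exists_ne_map_eq_of_infinite (fun k : ℕ => f^[k + 1])
    rcases hne.lt_or_gt with hlt | hlt
    · exact ⟨m, n, hlt, h⟩
    · exact ⟨n, m, hlt, h.symm⟩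
  obtain ⟨p, rfl⟩ := Nat.exists_eq_add_of_lt hmn
  have hper : ∀ k, f^[(p + 1) + (m + 1 + k)] = f^[m + 1 + k] := by
    intro k
    rw [show (p + 1) + (m + 1 + k) = (m + p + 1 + 1) + k by ring, Function.iterate_add, ← h,
      ← Function.iterate_add]
  have hmul : ∀ j k, f^[j * (p + 1) + (m + 1 + k)] = f^[m + 1 + k] := by
    intro j
    induction j with
    | zero => simp
    | succ j ih =>
      intro k
      rw [show (j + 1) * (p + 1) + (m + 1 + k) = j * (p + 1) + (m + 1 + (k + (p + 1))) by ring,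
        ih, show m + 1 + (k + (p + 1)) = (p + 1) + (m + 1 + k) by ring, hper]
  refine ⟨(m + 1) * (p + 1), by positivity, fun x => ?_⟩
  rw [← Function.iterate_add_apply]
  have := hmul (m + 1) ((m + 1) * p)
  rw [show m + 1 + (m + 1) * p = (m + 1) * (p + 1) by ring] at this
  rw [this]

theorem IsCore.surjective {A : RelStruct I δ} (hA : A.IsCore) {f : A.carrier → A.carrier}
    (hf : IsHom A A f) : Function.Surjective f := by
  have := A.finite
  obtain ⟨n, hn, hidem⟩ := exists_iterate_idempotent f
  have hsurj : Function.Surjective f^[n] := by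
    refine hA _ ⟨hf.iterate n, ?_⟩
    rintro _ ⟨x, rfl⟩
    exact hidem x
  obtain ⟨k, rfl⟩ : ∃ k, n = k + 1 := ⟨n - 1, by omega⟩
  rw [Function.iterate_succ'] at hsurj
  exact hsurj.of_comp

theorem IsCore.mem_of_homTo_substruct {A : RelStruct I δ} (hA : A.IsCore)
    {S : Set A.carrier} {hS : S.Nonempty} (h : A.HomTo (A.Substruct S hS)) (x : A.carrier) :
    x ∈ S := by
  obtain ⟨f, hf⟩ := h
  obtain ⟨y, rfl⟩ := hA.surjective (f := Subtype.val ∘ f) (fun i e he => hf i e he) x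
  exact (f y).2

theorem reflTransGen_shadowAdj_of_mem_rel {A : RelStruct I δ} {i : I}
    {e : Fin (δ i) → A.carrier} (he : e ∈ A.rel i) (j k : Fin (δ i)) :
    Relation.ReflTransGen (shadowAdj A) (e j) (e k) := by
  have : Std.Symm (shadowAdj A) := ⟨fun _ _ ⟨s, hs⟩ => ⟨s, hs.symm⟩⟩
  have hzero : ∀ (n : ℕ) (hn : n < δ i),
      Relation.ReflTransGen (shadowAdj A) (e ⟨0, by omega⟩) (e ⟨n, hn⟩) := by
    intro n
    induction n with
    | zero => exact fun _ => .refl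
    | succ n ih => exact fun hn => (ih (by omega)).tail ⟨⟨i, e, he, n, hn⟩, Or.inl ⟨rfl, rfl⟩⟩
  exact (Std.Symm.symm _ _ (hzero j j.2)).trans (hzero k k.2)

theorem homTo_sum_substruct_compl (hδ : ∀ i, 0 < δ i) (A : RelStruct I δ) (S : Set A.carrier)
    (hS : S.Nonempty) (hSc : Sᶜ.Nonempty)
    (hclosed : ∀ a b, Relation.ReflTransGen (shadowAdj A) a b → a ∈ S → b ∈ S) :
    A.HomTo ((A.Substruct S hS).sum (A.Substruct Sᶜ hSc)) := by
  classical
  refine ⟨fun x => if h : x ∈ S then Sum.inl ⟨x, h⟩ else Sum.inr ⟨x, h⟩, fun i e he => ?_⟩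
  by_cases h : e ⟨0, hδ i⟩ ∈ S
  · have hall : ∀ j, e j ∈ S := fun j =>
      hclosed _ _ (reflTransGen_shadowAdj_of_mem_rel he ⟨0, hδ i⟩ j) h
    exact Or.inl ⟨fun j => ⟨e j, hall j⟩, he, funext fun j => dif_pos (hall j)⟩
  · have hall : ∀ j, e j ∉ S := fun j hj =>
      h (hclosed _ _ (reflTransGen_shadowAdj_of_mem_rel he j ⟨0, hδ i⟩) hj)
    exact Or.inr ⟨fun j => ⟨e j, hall j⟩, he, funext fun j => dif_neg (hall j)⟩

theorem IsHom.isLeft_eq_of_shadowConnected {G A B : RelStruct I δ} (hG : ShadowConnected G)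
    {f : G.carrier → (A.sum B).carrier} (hf : IsHom G (A.sum B) f) (x y : G.carrier) :
    Sum.isLeft (f x) = Sum.isLeft (f y) := by
  have hstep : ∀ s : ShadowEdge G, Sum.isLeft (f s.src) = Sum.isLeft (f s.tgt) := by
    rintro ⟨i, e, he, j, hj⟩
    have hval : ∀ k, f (e k) = (f ∘ e) k := fun _ => rfl
    rcases hf i e he with ⟨ea, -, h⟩ | ⟨eb, -, h⟩ <;>
      simp only [ShadowEdge.src, ShadowEdge.tgt, hval, h] <;> rfl
  induction hG x y with
  | refl => rfl
  | tail _ hadj ih =>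
    obtain ⟨s, ⟨rfl, rfl⟩ | ⟨rfl, rfl⟩⟩ := hadj
    · exact ih.trans (hstep s)
    · exact ih.trans (hstep s).symm

theorem ShadowConnected.homTo_or_homTo_of_homTo_sum (hδ : ∀ i, 0 < δ i) {G A B : RelStruct I δ}
    (hG : ShadowConnected G) (h : G.HomTo (A.sum B)) : G.HomTo A ∨ G.HomTo B := by
  obtain ⟨f, hf⟩ := h
  have hside := hf.isLeft_eq_of_shadowConnected hG
  obtain ⟨x₀⟩ := G.nonempty
  cases hx₀ : f x₀ with
  | inl _ =>
    left
    have hex : ∀ x, ∃ a : A.carrier, f x = Sum.inl a := fun x =>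
      Sum.isLeft_iff.mp ((hside x x₀).trans (by rw [hx₀]; rfl))
    choose g hg using hex
    refine ⟨g, fun i e he => ?_⟩
    rcases hf i e he with ⟨ea, hea, h⟩ | ⟨eb, -, h⟩
    · have : g ∘ e = ea := funext fun j => Sum.inl_injective ((hg (e j)).symm.trans (congrFun h j))
      rwa [this]
    · exact absurd ((hg _).symm.trans (congrFun h ⟨0, hδ i⟩)) Sum.inl_ne_inr
  | inr _ =>
    right
    have hex : ∀ x, ∃ b : B.carrier, f x = Sum.inr b := fun x =>
      Sum.isRight_iff.mp (Sum.isLeft_eq_false.mp ((hside x x₀).trans (by rw [hx₀]; rfl)))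
    choose g hg using hex
    refine ⟨g, fun i e he => ?_⟩
    rcases hf i e he with ⟨ea, -, h⟩ | ⟨eb, heb, h⟩
    · exact absurd ((hg _).symm.trans (congrFun h ⟨0, hδ i⟩)) Sum.inr_ne_inl
    · have : g ∘ e = eb := funext fun j => Sum.inr_injective ((hg (e j)).symm.trans (congrFun h j))
      rwa [this]

theorem IsCore.shadowConnected_of_homEquiv_sum (hδ : ∀ i, 0 < δ i) {G : RelStruct I δ}
    (hG : G.IsCore)
    (h : ∀ A B : RelStruct I δ, G.HomEquiv (A.sum B) → G.HomEquiv A ∨ G.HomEquiv B) :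
    ShadowConnected G := by
  intro a b
  by_contra hab
  let S : Set G.carrier := {c | Relation.ReflTransGen (shadowAdj G) a c}
  have ha : a ∈ S := Relation.ReflTransGen.refl
  have hS : S.Nonempty := ⟨a, ha⟩
  have hSc : Sᶜ.Nonempty := ⟨b, hab⟩
  have hequiv : G.HomEquiv ((G.Substruct S hS).sum (G.Substruct Sᶜ hSc)) :=
    ⟨homTo_sum_substruct_compl hδ G S hS hSc fun _ _ hcd hc => hc.trans hcd,
      sum_homTo (substruct_homTo G S hS) (substruct_homTo G Sᶜ hSc)⟩
  rcases h _ _ hequiv with h | h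
  · exact hab (hG.mem_of_homTo_substruct h.1 b)
  · exact hG.mem_of_homTo_substruct h.1 a ha

end RelStruct

end ThesisFormal

open ThesisFormal RelStruct in
/-- For a core Δ-structure `G` the following are equivalent:
(1) `G → A + B` implies `G → A` or `G → B`;
(2) `G ≈ A + B` implies `A → B` or `B → A`;
(3) `G ≈ A + B` implies `G ≈ A` or `G ≈ B`;
(4) the shadow of `G` is connected. -/
theorem stmt_5 {I : Type} [Finite I] {δ : I → ℕ} (hδ : ∀ i, 2 ≤ δ i)
    (G : RelStruct I δ) (hG : G.IsCore) :
    ((∀ A B : RelStruct I δ, G.HomTo (A.sum B) → G.HomTo A ∨ G.HomTo B) ↔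
      (∀ A B : RelStruct I δ, G.HomEquiv (A.sum B) → A.HomTo B ∨ B.HomTo A)) ∧
    ((∀ A B : RelStruct I δ, G.HomEquiv (A.sum B) → A.HomTo B ∨ B.HomTo A) ↔
      (∀ A B : RelStruct I δ, G.HomEquiv (A.sum B) → G.HomEquiv A ∨ G.HomEquiv B)) ∧
    ((∀ A B : RelStruct I δ, G.HomEquiv (A.sum B) → G.HomEquiv A ∨ G.HomEquiv B) ↔
      ShadowConnected G) := by
  have hpos : ∀ i, 0 < δ i := fun i => lt_of_lt_of_le two_pos (hδ i)
  have h13 : (∀ A B : RelStruct I δ, G.HomTo (A.sum B) → G.HomTo A ∨ G.HomTo B) →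
      ∀ A B : RelStruct I δ, G.HomEquiv (A.sum B) → G.HomEquiv A ∨ G.HomEquiv B :=
    fun h A B hAB => (h A B hAB.1).imp (fun hA => ⟨hA, (homTo_sum_left A B).trans hAB.2⟩)
      (fun hB => ⟨hB, (homTo_sum_right A B).trans hAB.2⟩)
  have h32 : (∀ A B : RelStruct I δ, G.HomEquiv (A.sum B) → G.HomEquiv A ∨ G.HomEquiv B) →
      ∀ A B : RelStruct I δ, G.HomEquiv (A.sum B) → A.HomTo B ∨ B.HomTo A :=
    fun h A B hAB => (h A B hAB).symm.imp
      (fun hB => ((homTo_sum_left A B).trans hAB.2).trans hB.1)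
      (fun hA => ((homTo_sum_right A B).trans hAB.2).trans hA.1)
  have h23 : (∀ A B : RelStruct I δ, G.HomEquiv (A.sum B) → A.HomTo B ∨ B.HomTo A) →
      ∀ A B : RelStruct I δ, G.HomEquiv (A.sum B) → G.HomEquiv A ∨ G.HomEquiv B :=
    fun h A B hAB => (h A B hAB).symm.imp
      (fun hBA => ⟨hAB.1.trans (sum_homTo (.refl A) hBA), (homTo_sum_left A B).trans hAB.2⟩)
      (fun hBA => ⟨hAB.1.trans (sum_homTo hBA (.refl B)), (homTo_sum_right A B).trans hAB.2⟩)
  have h34 := hG.shadowConnected_of_homEquiv_sum hpos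
  have h41 : ShadowConnected G →
      ∀ A B : RelStruct I δ, G.HomTo (A.sum B) → G.HomTo A ∨ G.HomTo B :=
    fun h _ _ => h.homTo_or_homTo_of_homTo_sum hpos
  exact ⟨⟨fun h => h32 (h13 h), fun h => h41 (h34 (h23 h))⟩, ⟨h23, h32⟩,
    ⟨h34, fun h => h13 (h41 h)⟩⟩
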